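/- Let A be a triassociative algebra over a field K and M a K-vector space. Then A-representation structures on M are in bijective correspondence with left UA-module structures on M, via α_l(a)·x = a ⊣ x, α_r(a)·x = a ⊢ x, α_m(a)·x = a ⊥ x, β_l(a)·x = x ⊣ a, β_r(a)·x = x ⊢ a, β_m(a)·x = x ⊥ a. -/

import Mathlib

set_option maxHeartbeats 1000000
noncomputable section
namespace Trias

/-- The three binary operations of a triassociative algebra:
`lt` = left `⊣`, `rt` = right `⊢`, `md` = middle `⊥`. -/
inductive Tri : Type where
  | lt : Tri
  | rt : Tri
  | md : Tri
deriving DecidableEq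
/-- The list of the 11 triassociative algebra axioms.  A quadruple
`(a, b, c, d)` encodes the axiom `(x ∘ₐ y) ∘_b z = x ∘_c (y ∘_d z)`,
where `lt = ⊣`, `rt = ⊢`, `md = ⊥`.  The 11 entries are, in order, the
axioms (1)-(11) of Loday-Ronco:
`(x⊣y)⊣z = x⊣(y⊣z)`, `(x⊣y)⊣z = x⊣(y⊢z)`, `(x⊢y)⊣z = x⊢(y⊣z)`,
`(x⊣y)⊢z = x⊢(y⊢z)`, `(x⊢y)⊢z = x⊢(y⊢z)`, `(x⊣y)⊣z = x⊣(y⊥z)`,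
`(x⊥y)⊣z = x⊥(y⊣z)`, `(x⊣y)⊥z = x⊥(y⊢z)`, `(x⊢y)⊥z = x⊢(y⊥z)`,
`(x⊥y)⊢z = x⊢(y⊢z)`, `(x⊥y)⊥z = x⊥(y⊥z)`. -/
def axiomList : List (Tri × Tri × Tri × Tri) :=
  [(.lt, .lt, .lt, .lt), (.lt, .lt, .lt, .rt), (.rt, .lt, .rt, .lt),
   (.lt, .rt, .rt, .rt), (.rt, .rt, .rt, .rt), (.lt, .lt, .lt, .md),
   (.md, .lt, .md, .lt), (.lt, .md, .md, .rt), (.rt, .md, .rt, .md),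
   (.md, .rt, .rt, .rt), (.md, .md, .md, .md)]

/-- A triassociative algebra over a field `K`: a `K`-vector space `A`
equipped with three bilinear operations `op lt = ⊣`, `op rt = ⊢`,
`op md = ⊥` satisfying the 11 triassociative axioms. -/
structure TriasAlg (K : Type*) [Field K] (A : Type*) [AddCommGroup A] [Module K A] where
  op : Tri → A →ₗ[K] A →ₗ[K] A
  ax : ∀ p ∈ axiomList, ∀ x y z : A,
    op p.2.1 (op p.1 x y) z = op p.2.2.1 x (op p.2.2.2 y z)

/-- A representation `M` of a triassociative algebra `A`: three left
operations `lact s : A ⊗ M → M` and three right operations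
`ract s : M ⊗ A → M` (`s ∈ {⊣, ⊢, ⊥}`) satisfying the 11 triassociative
axioms whenever exactly one of the three arguments is in `M` (33 axioms). -/
structure TriasRep {K : Type*} [Field K] {A : Type*} [AddCommGroup A] [Module K A]
    (T : TriasAlg K A) (M : Type*) [AddCommGroup M] [Module K M] where
  lact : Tri → A →ₗ[K] M →ₗ[K] M
  ract : Tri → M →ₗ[K] A →ₗ[K] M
  axM : ∀ p ∈ axiomList, ∀ (x : M) (y z : A),
    ract p.2.1 (ract p.1 x y) z = ract p.2.2.1 x (T.op p.2.2.2 y z)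
  axMid : ∀ p ∈ axiomList, ∀ (x : A) (y : M) (z : A),
    ract p.2.1 (lact p.1 x y) z = lact p.2.2.1 x (ract p.2.2.2 y z)
  axA : ∀ p ∈ axiomList, ∀ (x y : A) (z : M),
    lact p.2.1 (T.op p.1 x y) z = lact p.2.2.1 x (lact p.2.2.2 y z)

/-- Every triassociative algebra is a representation of itself. -/
def TriasAlg.selfRep {K : Type*} [Field K] {A : Type*} [AddCommGroup A] [Module K A]
    (T : TriasAlg K A) : TriasRep T A where
  lact := T.op
  ract := T.op
  axM := T.ax
  axMid := T.ax
  axA := T.ax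
section UEA

/-- The six generators of the universal enveloping algebra: `α_l, α_r, α_m`
(for the left actions by `⊣, ⊢, ⊥`) and `β_l, β_r, β_m` (for the right
actions). -/
inductive Gen6 : Type where
  | al : Gen6
  | ar : Gen6
  | am : Gen6
  | bl : Gen6
  | br : Gen6
  | bm : Gen6
deriving DecidableEq

/-- `α_s` for `s ∈ {⊣, ⊢, ⊥}`. -/
def ag : Tri → Gen6
  | .lt => .al
  | .rt => .ar
  | .md => .am

/-- `β_s` for `s ∈ {⊣, ⊢, ⊥}`. -/
def bg : Tri → Gen6
  | .lt => .bl
  | .rt => .br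
  | .md => .bm

variable (K : Type*) [Field K] (A : Type*) [AddCommGroup A] [Module K A]

/-- The free unital associative algebra on six copies
`α_l A ⊕ α_r A ⊕ α_m A ⊕ β_l A ⊕ β_r A ⊕ β_m A` of `A`. -/
abbrev FreeUA : Type _ := TensorAlgebra K (Gen6 → A)

/-- The generator `γ(a)` of the free algebra, for `γ ∈ {α_l, …, β_m}`,
`a ∈ A`. -/
def gen (g : Gen6) (a : A) : FreeUA K A :=
  TensorAlgebra.ι K (Pi.single g a)

variable {K A}

/-- The 33 relations defining the universal enveloping algebra `UA`
(three for each of the 11 triassociative axioms `(a,b,c,d)`, i.e.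
`(x ∘ₐ y) ∘_b z = x ∘_c (y ∘_d z)`):
`β_b(z)·β_a(y) = β_c(y ∘_d z)`, `β_b(z)·α_a(x) = α_c(x)·β_d(z)`,
`α_b(x ∘ₐ y) = α_c(x)·α_d(y)`. -/
inductive URel (T : TriasAlg K A) : FreeUA K A → FreeUA K A → Prop where
  | rel1 : ∀ p ∈ axiomList, ∀ y z : A,
      URel T (gen K A (bg p.2.1) z * gen K A (bg p.1) y)
             (gen K A (bg p.2.2.1) (T.op p.2.2.2 y z))
  | rel2 : ∀ p ∈ axiomList, ∀ x z : A,
      URel T (gen K A (bg p.2.1) z * gen K A (ag p.1) x)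
             (gen K A (ag p.2.2.1) x * gen K A (bg p.2.2.2) z)
  | rel3 : ∀ p ∈ axiomList, ∀ x y : A,
      URel T (gen K A (ag p.2.1) (T.op p.1 x y))
             (gen K A (ag p.2.2.1) x * gen K A (ag p.2.2.2) y)

/-- The universal enveloping algebra `UA` of a triassociative algebra `A`:
the quotient of the free unital associative `K`-algebra on six copies of `A`
by the 33 relations. -/
abbrev UA (T : TriasAlg K A) : Type _ := RingQuot (URel T)

/-- The generator `γ(a) ∈ UA`, for `γ ∈ {α_l, α_r, α_m, β_l, β_r, β_m}`. -/
def genU (T : TriasAlg K A) (g : Gen6) (a : A) : UA T :=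
  RingQuot.mkAlgHom K (URel T) (gen K A g a)

end UEA

section Rep6

variable {K : Type*} [Field K] {A : Type*} [AddCommGroup A] [Module K A]
  (T : TriasAlg K A) (M : Type*) [AddCommGroup M] [Module K M]

/-- The scalar multiplication of a (left) `UA`-module structure `P` on `M`. -/
def psmul (P : Module (UA T) M) (u : UA T) (x : M) : M :=
  @SMul.smul _ _ P.toDistribMulAction.toMulAction.toSMul u x

/-- Left `UA`-module structures on the `K`-vector space `M` whose underlying
`K`-module structure (restriction of scalars along `K → UA`) is the given
one. -/
def CompatMod : Type _ :=
  { P : Module (UA T) M //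
      ∀ (k : K) (x : M), psmul T M P (algebraMap K (UA T) k) x = k • x }

end Rep6

section Universal

variable {K : Type*} [Field K] {A : Type*} [AddCommGroup A] [Module K A]

instance : Fintype Gen6 where
  elems := {.al, .ar, .am, .bl, .br, .bm}
  complete g := by cases g <;> decide

theorem Gen6.exists_eq_ag_or_bg (g : Gen6) : ∃ s, g = ag s ∨ g = bg s := by
  cases g
  exacts [⟨.lt, .inl rfl⟩, ⟨.rt, .inl rfl⟩, ⟨.md, .inl rfl⟩,
    ⟨.lt, .inr rfl⟩, ⟨.rt, .inr rfl⟩, ⟨.md, .inr rfl⟩]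

/-- The generators `γ(a)` of the universal enveloping algebra, linearly in `a`. -/
def genULinear (T : TriasAlg K A) (g : Gen6) : A →ₗ[K] UA T :=
  (RingQuot.mkAlgHom K (URel T)).toLinearMap ∘ₗ TensorAlgebra.ι K ∘ₗ
    LinearMap.single K (fun _ : Gen6 => A) g

@[simp]
theorem genULinear_apply (T : TriasAlg K A) (g : Gen6) (a : A) :
    genULinear T g a = genU T g a :=
  rfl

/-- An algebra homomorphism out of the universal enveloping algebra is determined by its values
on generators. -/
theorem UA.algHom_ext {T : TriasAlg K A} {S : Type*} [Semiring S] [Algebra K S]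
    {f f' : UA T →ₐ[K] S} (h : ∀ g a, f (genU T g a) = f' (genU T g a)) : f = f' := by
  refine RingQuot.ringQuot_ext' K f f' (TensorAlgebra.hom_ext (LinearMap.pi_ext' ?_))
  exact fun g => LinearMap.ext (h g)

theorem genU_bg_mul_bg (T : TriasAlg K A) {p : Tri × Tri × Tri × Tri} (hp : p ∈ axiomList)
    (y z : A) :
    genU T (bg p.2.1) z * genU T (bg p.1) y = genU T (bg p.2.2.1) (T.op p.2.2.2 y z) := by
  simpa only [genU, map_mul] using RingQuot.mkAlgHom_rel K (URel.rel1 (T := T) p hp y z)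

theorem genU_bg_mul_ag (T : TriasAlg K A) {p : Tri × Tri × Tri × Tri} (hp : p ∈ axiomList)
    (x z : A) :
    genU T (bg p.2.1) z * genU T (ag p.1) x = genU T (ag p.2.2.1) x * genU T (bg p.2.2.2) z := by
  simpa only [genU, map_mul] using RingQuot.mkAlgHom_rel K (URel.rel2 (T := T) p hp x z)

theorem genU_ag_op (T : TriasAlg K A) {p : Tri × Tri × Tri × Tri} (hp : p ∈ axiomList)
    (x y : A) :
    genU T (ag p.2.1) (T.op p.1 x y) = genU T (ag p.2.2.1) x * genU T (ag p.2.2.2) y := by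
  simpa only [genU, map_mul] using RingQuot.mkAlgHom_rel K (URel.rel3 (T := T) p hp x y)

end Universal

section Correspondence

variable {K : Type*} [Field K] {A : Type*} [AddCommGroup A] [Module K A]
  {T : TriasAlg K A} {M : Type*} [AddCommGroup M] [Module K M]

namespace TriasRep

@[ext]
theorem ext {R R' : TriasRep T M} (hl : R.lact = R'.lact) (hr : R.ract = R'.ract) : R = R' := by
  cases R
  cases R'
  subst hl hr
  rfl

/-- The endomorphisms of a representation by which the generators act. -/
def act (R : TriasRep T M) : Gen6 → A →ₗ[K] Module.End K M
  | .al => R.lact .lt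
  | .ar => R.lact .rt
  | .am => R.lact .md
  | .bl => (R.ract .lt).flip
  | .br => (R.ract .rt).flip
  | .bm => (R.ract .md).flip

@[simp]
theorem act_ag (R : TriasRep T M) (s : Tri) (a : A) (x : M) :
    R.act (ag s) a x = R.lact s a x := by
  cases s <;> rfl

@[simp]
theorem act_bg (R : TriasRep T M) (s : Tri) (a : A) (x : M) :
    R.act (bg s) a x = R.ract s x a := by
  cases s <;> rfl

/-- The action of the free algebra on a representation. -/
def freeHom (R : TriasRep T M) : FreeUA K A →ₐ[K] Module.End K M :=
  TensorAlgebra.lift K (LinearMap.lsum K (fun _ : Gen6 => A) K R.act)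

@[simp]
theorem freeHom_gen (R : TriasRep T M) (g : Gen6) (a : A) :
    R.freeHom (gen K A g a) = R.act g a := by
  rw [freeHom, gen, TensorAlgebra.lift_ι_apply, LinearMap.lsum_piSingle]

theorem freeHom_eq_of_rel (R : TriasRep T M) ⦃u v : FreeUA K A⦄ (h : URel T u v) :
    R.freeHom u = R.freeHom v := by
  ext m
  cases h with
  | rel1 p hp y z => simpa using R.axM p hp m y z
  | rel2 p hp x z => simpa using R.axMid p hp x m z
  | rel3 p hp x y => simpa using R.axA p hp x y m

/-- The action of the universal enveloping algebra on a representation. -/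
def toAlgHom (R : TriasRep T M) : UA T →ₐ[K] Module.End K M :=
  RingQuot.liftAlgHom K ⟨R.freeHom, R.freeHom_eq_of_rel⟩

@[simp]
theorem toAlgHom_genU (R : TriasRep T M) (g : Gen6) (a : A) :
    R.toAlgHom (genU T g a) = R.act g a := by
  rw [toAlgHom, genU, RingQuot.liftAlgHom_mkAlgHom_apply, freeHom_gen]

/-- The representation defined by an action of the universal enveloping algebra. -/
def ofAlgHom (f : UA T →ₐ[K] Module.End K M) : TriasRep T M where
  lact s := f.toLinearMap ∘ₗ genULinear T (ag s)
  ract s := (f.toLinearMap ∘ₗ genULinear T (bg s)).flip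
  axM p hp x y z := by
    simpa using congr(f $(genU_bg_mul_bg T hp y z) x)
  axMid p hp x y z := by
    simpa using congr(f $(genU_bg_mul_ag T hp x z) y)
  axA p hp x y z := by
    simpa using congr(f $(genU_ag_op T hp x y) z)

/-- Representations on `M` correspond to algebra homomorphisms from the universal enveloping
algebra to the endomorphisms of `M`. -/
def equivAlgHom : TriasRep T M ≃ (UA T →ₐ[K] Module.End K M) where
  toFun := toAlgHom
  invFun := ofAlgHom
  left_inv R := by
    ext s <;> simp [ofAlgHom]
  right_inv f := by
    refine UA.algHom_ext fun g a => ?_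
    obtain ⟨s, rfl | rfl⟩ := g.exists_eq_ag_or_bg <;> ext x <;> simp [ofAlgHom]

end TriasRep

namespace CompatMod

/-- The module structure defined by an action by endomorphisms. -/
def ofAlgHom (f : UA T →ₐ[K] Module.End K M) : CompatMod T M :=
  ⟨Module.compHom M f.toRingHom, fun k x => congr($(f.commutes k) x)⟩

@[simp]
theorem psmul_ofAlgHom (f : UA T →ₐ[K] Module.End K M) (u : UA T) (x : M) :
    psmul T M (ofAlgHom f).1 u x = f u x :=
  rfl

/-- The action by endomorphisms underlying a compatible module structure. -/
def toAlgHom (P : CompatMod T M) : UA T →ₐ[K] Module.End K M :=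
  letI : Module (UA T) M := P.1
  haveI : IsScalarTower K (UA T) M := .of_algebraMap_smul P.2
  Algebra.lsmul K K M

@[simp]
theorem toAlgHom_apply (P : CompatMod T M) (u : UA T) (x : M) :
    P.toAlgHom u x = psmul T M P.1 u x :=
  rfl

/-- Algebra homomorphisms from the universal enveloping algebra to the endomorphisms of `M`
correspond to compatible module structures on `M`. -/
def algHomEquiv : (UA T →ₐ[K] Module.End K M) ≃ CompatMod T M where
  toFun := ofAlgHom
  invFun := toAlgHom
  left_inv _ := rfl
  right_inv P := Subtype.ext (Module.ext' _ P.1 fun _ _ => rfl)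

end CompatMod

end Correspondence

/-- **Proposition (representations are left `UA`-modules).**
Let `A` be a triassociative algebra over a field `K` and `M` a `K`-vector
space.  Then `A`-representation structures on `M` are in bijective
correspondence with left `UA`-module structures on `M`, via
`α_l(a)·x = a ⊣ x`, `α_r(a)·x = a ⊢ x`, `α_m(a)·x = a ⊥ x`,
`β_l(a)·x = x ⊣ a`, `β_r(a)·x = x ⊢ a`, `β_m(a)·x = x ⊥ a`. -/
theorem rep_equiv_UA_module {K : Type*} [Field K] {A : Type*} [AddCommGroup A]
    [Module K A] (T : TriasAlg K A) (M : Type*) [AddCommGroup M] [Module K M] :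
    ∃ e : TriasRep T M ≃ CompatMod T M,
      ∀ (R : TriasRep T M) (s : Tri) (a : A) (x : M),
        psmul T M (e R).1 (genU T (ag s) a) x = R.lact s a x ∧
        psmul T M (e R).1 (genU T (bg s) a) x = R.ract s x a := by
  refine ⟨TriasRep.equivAlgHom.trans CompatMod.algHomEquiv, fun R s a x => ?_⟩
  change psmul T M (CompatMod.ofAlgHom R.toAlgHom).1 _ x = _ ∧
    psmul T M (CompatMod.ofAlgHom R.toAlgHom).1 _ x = _
  simp

end Trias
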